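/- Let X be a Hadamard space. Given ε > 0, a > 0 and R > 0, there exists T = T(ε,a,R) > 0 such that: for any x, y ∈ X with d(x,y) = a and any unit-speed geodesic (possibly ray) (μ_t) in W₂(X) of length greater than T starting at δ_y, if (σ^s_t)_t denotes the unit-speed geodesic of W₂(X) from δ_x to μ_s, then W(σ^s_R, σ^{s'}_R) < ε for all s' > s > T. In particular, if (μ_t) is a ray, then as s → ∞ the geodesics σ^s converge uniformly on compact subsets of [0,∞) to the unique unit-speed ray from δ_x in the asymptote class of (μ_t). -/

import Mathlib

open MeasureTheory Filter Set Topology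
open scoped NNReal ENNReal

noncomputable section


/-! ## Geodesics and Hadamard spaces -/

/-- `γ` is a geodesic on the set of parameters `s`, of speed `v`, with respect to the
distance function `d`. -/
def IsGeodesicOnWith {A : Type*} (d : A → A → ℝ) (γ : ℝ → A) (s : Set ℝ) (v : ℝ) : Prop :=
  ∀ t ∈ s, ∀ t' ∈ s, d (γ t) (γ t') = v * |t - t'|

/-- A metric space is geodesic if any two points are joined by a geodesic. -/
def IsGeodesicSpace (Y : Type*) [MetricSpace Y] : Prop :=
  ∀ x y : Y, ∃ γ : ℝ → Y, γ 0 = x ∧ γ 1 = y ∧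
    IsGeodesicOnWith dist γ (Set.Icc (0:ℝ) 1) (dist x y)

/-- Every geodesic segment extends to a complete geodesic (defined on all of `ℝ`). -/
def GeodesicallyComplete (Y : Type*) [MetricSpace Y] : Prop :=
  ∀ (γ : ℝ → Y) (a b v : ℝ), a < b → IsGeodesicOnWith dist γ (Set.Icc a b) v →
    ∃ g : ℝ → Y, IsGeodesicOnWith dist g Set.univ v ∧ ∀ t ∈ Set.Icc a b, g t = γ t

/-- A Hadamard space: complete, separable, locally compact, geodesic, globally CAT(0).
The CAT(0) comparison inequality is expressed through the explicit formula for the distance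
from a vertex to a point of the opposite side in the Euclidean comparison triangle. -/
structure IsHadamard (X : Type*) [MetricSpace X] : Prop where
  complete : CompleteSpace X
  separable : TopologicalSpace.SeparableSpace X
  locallyCompact : LocallyCompactSpace X
  geodesic : IsGeodesicSpace X
  cat0 : ∀ (x y z : X) (γ : ℝ → X), γ 0 = y → γ 1 = z →
    IsGeodesicOnWith dist γ (Set.Icc (0:ℝ) 1) (dist y z) →
    ∀ t ∈ Set.Icc (0:ℝ) 1,
      dist x (γ t) ^ 2 ≤ (1 - t) * dist x y ^ 2 + t * dist x z ^ 2 - t * (1 - t) * dist y z ^ 2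

/-- A space is non-branching if two geodesics coinciding on a nonempty open set of parameters
coincide on their whole common interval of definition. -/
def NonBranching (X : Type*) [MetricSpace X] : Prop :=
  ∀ (γ β : ℝ → X) (I : Set ℝ) (v w : ℝ),
    IsGeodesicOnWith dist γ I v → IsGeodesicOnWith dist β I w →
    (∃ U : Set ℝ, U ⊆ I ∧ IsOpen U ∧ U.Nonempty ∧ ∀ t ∈ U, γ t = β t) →
    ∀ t ∈ I, γ t = β t

/-! ## The Wasserstein space -/

/-- `π` is a coupling (transport plan) between `μ` and `ν`. -/
def IsCoupling {A B : Type*} [MeasurableSpace A] [MeasurableSpace B]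
    (π : Measure (A × B)) (μ : Measure A) (ν : Measure B) : Prop :=
  π.map Prod.fst = μ ∧ π.map Prod.snd = ν

/-- The quadratic Wasserstein space over `Y`: Borel probability measures with finite second
moment. -/
abbrev W2Space (Y : Type*) [MetricSpace Y] [MeasurableSpace Y] : Type _ :=
  {μ : Measure Y // IsProbabilityMeasure μ ∧
    ∃ x₀ : Y, (∫⁻ x, ENNReal.ofReal (dist x₀ x) ^ 2 ∂μ) < ⊤}

/-- The quadratic transport cost between two measures. -/
def W2cost {Y : Type*} [MetricSpace Y] [MeasurableSpace Y] (μ ν : Measure Y) : ℝ≥0∞ :=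
  ⨅ (π : Measure (Y × Y)) (_ : IsCoupling π μ ν),
    ∫⁻ p, ENNReal.ofReal (dist p.1 p.2) ^ 2 ∂π

/-- The quadratic Wasserstein distance. -/
def Wdist {Y : Type*} [MetricSpace Y] [MeasurableSpace Y] (μ ν : W2Space Y) : ℝ :=
  Real.sqrt (W2cost μ.1 ν.1).toReal


/-! ## Rays, complete geodesics, the boundary at infinity and the cone over it -/

/-- Geodesic rays of `X` (arbitrary nonnegative speed), parametrized by `ℝ≥0`.
The topology (of a subtype of a product) coincides on this set with the topology of
uniform convergence on compact sets. -/
abbrev RaySpace (X : Type*) [MetricSpace X] : Type _ :=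
  {γ : ℝ≥0 → X // ∃ v : ℝ, 0 ≤ v ∧ ∀ s t : ℝ≥0, dist (γ s) (γ t) = v * dist s t}

/-- Unit speed geodesic rays of `X`. -/
abbrev UnitRay (X : Type*) [MetricSpace X] : Type _ :=
  {γ : ℝ≥0 → X // ∀ s t : ℝ≥0, dist (γ s) (γ t) = dist s t}

/-- Complete geodesics of `X` (arbitrary nonnegative speed). -/
abbrev GeoLine (X : Type*) [MetricSpace X] : Type _ :=
  {γ : ℝ → X // ∃ v : ℝ, 0 ≤ v ∧ ∀ s t : ℝ, dist (γ s) (γ t) = v * |s - t|}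

/-- Complete unit speed geodesics of `X`. -/
abbrev UnitLine (X : Type*) [MetricSpace X] : Type _ :=
  {γ : ℝ → X // ∀ s t : ℝ, dist (γ s) (γ t) = |s - t|}

/-- Evaluation of a ray at time `t`. -/
def rayEval {X : Type*} [MetricSpace X] (t : ℝ≥0) : RaySpace X → X := fun γ => γ.1 t

/-- Two curves (w.r.t. a distance function `d`) are asymptotic if they stay at bounded
distance. -/
def AsymptoticMaps {A : Type*} (d : A → A → ℝ) (γ β : ℝ≥0 → A) : Prop :=
  ∃ C : ℝ, ∀ t, d (γ t) (β t) ≤ C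

/-- The asymptote relation on unit-speed rays. -/
def unitRaySetoid (X : Type*) [MetricSpace X] : Setoid (UnitRay X) where
  r γ β := AsymptoticMaps dist γ.1 β.1
  iseqv := by
    refine ⟨fun γ => ⟨0, fun t => by simp⟩, ?_, ?_⟩
    · rintro γ β ⟨C, h⟩
      exact ⟨C, fun t => by rw [dist_comm]; exact h t⟩
    · rintro γ β δ ⟨C, h⟩ ⟨C', h'⟩
      exact ⟨C + C', fun t => (dist_triangle _ _ _).trans (add_le_add (h t) (h' t))⟩

/-- The geodesic boundary of `X`: asymptote classes of unit-speed rays, with the quotient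
topology of the topology of uniform convergence on compact sets (the cone topology). -/
abbrev Boundary (X : Type*) [MetricSpace X] := Quotient (unitRaySetoid X)

/-- Apex-like points, to be collapsed when forming the cone over `B`. -/
def coneIsApex {B : Type*} : B × ℝ≥0 ⊕ Unit → Prop
  | Sum.inl p => p.2 = 0
  | Sum.inr _ => True

/-- The relation collapsing all apex-like points. -/
def coneSetoid (B : Type*) : Setoid (B × ℝ≥0 ⊕ Unit) where
  r p q := p = q ∨ (coneIsApex p ∧ coneIsApex q)
  iseqv := by
    refine ⟨fun p => Or.inl rfl, ?_, ?_⟩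
    · rintro p q (rfl | h)
      · exact Or.inl rfl
      · exact Or.inr ⟨h.2, h.1⟩
    · rintro p q r (rfl | h) (rfl | h')
      · exact Or.inl rfl
      · exact Or.inr h'
      · exact Or.inr h
      · exact Or.inr ⟨h.1, h'.2⟩

/-- The cone over a space `B`: the quotient of `B × [0,∞)` collapsing the zero level to the
apex, with the quotient topology. -/
abbrev Cone (B : Type*) := Quotient (coneSetoid B)

/-- The point of the cone over `b` at height (speed) `s`. -/
def coneMk {B : Type*} (b : B) (s : ℝ≥0) : Cone B :=
  Quotient.mk (coneSetoid B) (Sum.inl (b, s))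

/-- The apex of the cone. -/
def conePt (B : Type*) : Cone B := Quotient.mk (coneSetoid B) (Sum.inr ())

private def coneSpeedAux {B : Type*} : B × ℝ≥0 ⊕ Unit → ℝ≥0
  | Sum.inl p => p.2
  | Sum.inr _ => 0

/-- The speed (radial) coordinate of a point of the cone. -/
def coneSpeed {B : Type*} : Cone B → ℝ≥0 :=
  Quotient.lift coneSpeedAux (by
    rintro p q (rfl | ⟨h1, h2⟩)
    · rfl
    · cases p <;> cases q <;> simp_all [coneIsApex, coneSpeedAux])

/-- The speed of a geodesic ray. -/
def raySpeed {X : Type*} [MetricSpace X] (γ : RaySpace X) : ℝ≥0 :=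
  nndist (γ.1 0) (γ.1 1)

lemma raySpeed_eq {X : Type*} [MetricSpace X] (γ : RaySpace X) {v : ℝ} (hv0 : 0 ≤ v)
    (hv : ∀ s t : ℝ≥0, dist (γ.1 s) (γ.1 t) = v * dist s t) : (raySpeed γ : ℝ) = v := by
  have h1 := hv 0 1
  have h2 : dist (0 : ℝ≥0) (1 : ℝ≥0) = 1 := by rw [NNReal.dist_eq]; norm_num
  rw [h2, mul_one] at h1
  rw [show (raySpeed γ : ℝ) = dist (γ.1 0) (γ.1 1) from (dist_nndist _ _).symm, h1]

/-- The unit reparametrization of a nonconstant ray. -/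
def rayUnit {X : Type*} [MetricSpace X] (γ : RaySpace X) (h : raySpeed γ ≠ 0) : UnitRay X := by
  refine ⟨fun t => γ.1 (t / raySpeed γ), ?_⟩
  obtain ⟨v, hv0, hv⟩ := γ.2
  have hveq : (raySpeed γ : ℝ) = v := raySpeed_eq γ hv0 hv
  intro s t
  have hr : (raySpeed γ : ℝ) ≠ 0 := by
    simpa using h
  show dist (γ.1 (s / raySpeed γ)) (γ.1 (t / raySpeed γ)) = dist s t
  rw [hv, NNReal.dist_eq, NNReal.dist_eq, NNReal.coe_div, NNReal.coe_div,
    div_sub_div_same, abs_div, abs_of_nonneg (raySpeed γ).coe_nonneg, ← hveq]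
  field_simp

/-- The point at infinity (in the cone over the boundary) defined by a geodesic ray:
its asymptote class together with its speed; constant rays are sent to the apex. -/
def rayEnd {X : Type*} [MetricSpace X] (γ : RaySpace X) : Cone (Boundary X) :=
  if h : raySpeed γ = 0 then conePt (Boundary X)
  else coneMk (Quotient.mk (unitRaySetoid X) (rayUnit γ h)) (raySpeed γ)

/-! ## Asymptotic distance -/

def dInfty {X : Type*} [MetricSpace X] (γ β : ℝ≥0 → X) : ℝ :=
  Filter.limsup (fun t : ℝ≥0 => dist (γ t) (β t) / (t : ℝ)) Filter.atTop

/-- The asymptotic (angular) distance on the boundary, computed on representative rays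
(it does not depend on the choice of representatives). -/
def boundaryDist {X : Type*} [MetricSpace X] (ξ ζ : Boundary X) : ℝ :=
  dInfty (ξ.out).1 (ζ.out).1

def coneDistAux {X : Type*} [MetricSpace X] :
    Boundary X × ℝ≥0 ⊕ Unit → Boundary X × ℝ≥0 ⊕ Unit → ℝ
  | Sum.inl p, Sum.inl q =>
      Real.sqrt (((p.2 : ℝ) - (q.2 : ℝ)) ^ 2 + (p.2 : ℝ) * (q.2 : ℝ) * boundaryDist p.1 q.1 ^ 2)
  | Sum.inl p, Sum.inr _ => p.2
  | Sum.inr _, Sum.inl q => q.2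
  | Sum.inr _, Sum.inr _ => 0

/-- The asymptotic distance on the cone over the boundary (the cone metric). -/
def coneDist {X : Type*} [MetricSpace X] : Cone (Boundary X) → Cone (Boundary X) → ℝ :=
  Quotient.lift₂ coneDistAux (by
    rintro a₁ a₂ b₁ b₂ h12 h34
    rcases h12 with rfl | ⟨h1, h2⟩ <;> rcases h34 with rfl | ⟨h3, h4⟩
    · rfl
    · rcases a₁ with p | u <;> rcases a₂ with q | v <;> rcases b₂ with q' | w <;>
        simp_all [coneIsApex, coneDistAux, Real.sqrt_sq, NNReal.coe_nonneg]
    · rcases a₂ with q | u <;> rcases a₁ with p | v <;> rcases b₁ with p' | w <;>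
        simp_all [coneIsApex, coneDistAux, Real.sqrt_sq, NNReal.coe_nonneg]
    · rcases a₁ with p | u <;> rcases a₂ with q | v <;> rcases b₁ with p' | w <;>
        rcases b₂ with q' | w' <;>
        simp_all [coneIsApex, coneDistAux, Real.sqrt_sq, NNReal.coe_nonneg])


-- Borel measurable structure on the boundary and the cone over it.
instance (X : Type*) [MetricSpace X] : MeasurableSpace (Boundary X) := borel _
instance (X : Type*) [MetricSpace X] : BorelSpace (Boundary X) := ⟨rfl⟩
instance (X : Type*) [MetricSpace X] : MeasurableSpace (Cone (Boundary X)) := borel _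
instance (X : Type*) [MetricSpace X] : BorelSpace (Cone (Boundary X)) := ⟨rfl⟩

/-- The Wasserstein metric `W_∞` on measures on the cone over the boundary, built from the
cost `d_∞²`. -/
def Winfty {X : Type*} [MetricSpace X] (m m' : Measure (Cone (Boundary X))) : ℝ :=
  Real.sqrt (⨅ (π : Measure (Cone (Boundary X) × Cone (Boundary X)))
    (_ : IsCoupling π m m'),
      ∫⁻ p, ENNReal.ofReal (coneDist p.1 p.2) ^ 2 ∂π).toReal


/-! ## Visibility -/

/-- `X` is a visibility space: any two distinct boundary points are the two endpoints of a
complete geodesic. -/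
def IsVisibility (X : Type*) [MetricSpace X] : Prop :=
  ∀ α ω : UnitRay X, ¬ AsymptoticMaps dist α.1 ω.1 →
    ∃ g : ℝ → X, (∀ s t : ℝ, dist (g s) (g t) = |s - t|) ∧
      AsymptoticMaps dist (fun t : ℝ≥0 => g (-(t : ℝ))) α.1 ∧
      AsymptoticMaps dist (fun t : ℝ≥0 => g (t : ℝ)) ω.1

/-! ## Curves, length, rectifiability -/

/-- The length of a curve with respect to a distance function `d`, as a supremum over
finite monotone sequences of parameters in `[a,b]`. -/
def curveLengthWith {A : Type*} (d : A → A → ℝ) (c : ℝ → A) (a b : ℝ) : ℝ≥0∞ :=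
  ⨆ (n : ℕ) (t : Fin (n + 1) → ℝ) (_ : Monotone t) (_ : ∀ i, t i ∈ Set.Icc a b),
    ∑ i : Fin n, ENNReal.ofReal (d (c (t i.castSucc)) (c (t i.succ)))

/-- Continuity of a curve with respect to a distance function `d`, on a set of parameters. -/
def ContinuousWithRespect {A : Type*} (d : A → A → ℝ) (c : ℝ → A) (s : Set ℝ) : Prop :=
  ∀ t ∈ s, ∀ ε : ℝ, 0 < ε → ∃ δ : ℝ, 0 < δ ∧ ∀ u ∈ s, |u - t| < δ → d (c u) (c t) < ε

/-- `W_∞` between measures on the boundary, viewed as the level `{speed = 1}` of the cone,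
with cost `d_∞²`. -/
def WinftyLevel1 {X : Type*} [MetricSpace X] (m m' : Measure (Boundary X)) : ℝ :=
  Real.sqrt (⨅ (π : Measure (Boundary X × Boundary X)) (_ : IsCoupling π m m'),
    ∫⁻ p, ENNReal.ofReal (coneDist (coneMk p.1 1) (coneMk p.2 1)) ^ 2 ∂π).toReal

/-! ## Support of a measure -/

/-- The (topological) support of a measure. -/
def msupport {A : Type*} [TopologicalSpace A] [MeasurableSpace A] (μ : Measure A) : Set A :=
  {x | ∀ U : Set A, x ∈ U → IsOpen U → 0 < μ U}

/-! ## Cyclical monotonicity and antagonism -/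

/-- A set `Γ` is `c`-cyclically monotone if no cyclic permutation of the target points of a
finite family of pairs of `Γ` decreases the total cost. -/
def CyclicallyMonotone {A : Type*} (c : A → A → ℝ) (Γ : Set (A × A)) : Prop :=
  ∀ (m : ℕ) (p : Fin (m + 1) → A × A), (∀ i, p i ∈ Γ) →
    (∑ i, c (p i).1 (p i).2) ≤ ∑ i, c (p i).1 (p (i + 1)).2

/-- Two curves are antagonist if they pass through two distinct points in opposite orders. -/
def Antagonist {X : Type*} (γ β : ℝ → X) : Prop :=
  ∃ x y : X, x ≠ y ∧ (∃ s t : ℝ, s < t ∧ γ s = x ∧ γ t = y) ∧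
    (∃ s t : ℝ, s < t ∧ β s = y ∧ β t = x)

/-! ## Negative curvature, trees -/

/-- Three points lying on a common geodesic. -/
def Aligned {X : Type*} [MetricSpace X] (x y z : X) : Prop :=
  dist x y + dist y z = dist x z ∨ dist y x + dist x z = dist y z ∨
    dist x z + dist z y = dist x y

/-- `X` is negatively curved: it is not a line, and the CAT(0) comparison inequality is
strict except for aligned triangles. -/
def IsNegativelyCurved (X : Type*) [MetricSpace X] : Prop :=
  (¬ ∃ f : ℝ → X, Function.Surjective f ∧ ∀ s t : ℝ, dist (f s) (f t) = |s - t|) ∧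
  ∀ (x y z : X) (γ : ℝ → X), γ 0 = y → γ 1 = z →
    IsGeodesicOnWith dist γ (Set.Icc (0:ℝ) 1) (dist y z) → ¬ Aligned x y z →
    ∀ t ∈ Set.Ioo (0:ℝ) 1,
      dist x (γ t) ^ 2 < (1 - t) * dist x y ^ 2 + t * dist x z ^ 2 - t * (1 - t) * dist y z ^ 2

/-- A metric tree (real tree): a geodesic space satisfying the four-point 0-hyperbolicity
condition. -/
def IsRealTree (X : Type*) [MetricSpace X] : Prop :=
  IsGeodesicSpace X ∧ ∀ x y z w : X,
    dist x y + dist z w ≤ max (dist x z + dist y w) (dist x w + dist y z)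

/-! ## Ends of complete geodesics -/

/-- The forward ray of a complete geodesic. -/
def lineForward {X : Type*} [MetricSpace X] (γ : GeoLine X) : RaySpace X :=
  ⟨fun t : ℝ≥0 => γ.1 (t : ℝ), by
    obtain ⟨v, hv0, hv⟩ := γ.2
    exact ⟨v, hv0, fun s t => by rw [hv, NNReal.dist_eq]⟩⟩

/-- The backward ray of a complete geodesic. -/
def lineBackward {X : Type*} [MetricSpace X] (γ : GeoLine X) : RaySpace X :=
  ⟨fun t : ℝ≥0 => γ.1 (-(t : ℝ)), by
    obtain ⟨v, hv0, hv⟩ := γ.2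
    refine ⟨v, hv0, fun s t => ?_⟩
    rw [hv, NNReal.dist_eq]
    congr 1
    rw [abs_sub_comm]
    congr 1
    ring⟩

/-- The end at `+∞` of a complete geodesic, in the cone over the boundary. -/
def lineEndPlus {X : Type*} [MetricSpace X] (γ : GeoLine X) : Cone (Boundary X) :=
  rayEnd (lineForward γ)

/-- The end at `-∞` of a complete geodesic, in the cone over the boundary. -/
def lineEndMinus {X : Type*} [MetricSpace X] (γ : GeoLine X) : Cone (Boundary X) :=
  rayEnd (lineBackward γ)

/-- `g` is a unit complete geodesic with ends `ξ` (at `-∞`) and `ζ` (at `+∞`). -/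
def LineConnects {X : Type*} [MetricSpace X] (g : ℝ → X) (ξ ζ : Boundary X) : Prop :=
  (∀ s t : ℝ, dist (g s) (g t) = |s - t|) ∧
  (∃ γ : UnitRay X, Quotient.mk (unitRaySetoid X) γ = ξ ∧
    AsymptoticMaps dist (fun u : ℝ≥0 => g (-(u : ℝ))) γ.1) ∧
  (∃ γ : UnitRay X, Quotient.mk (unitRaySetoid X) γ = ζ ∧
    AsymptoticMaps dist (fun u : ℝ≥0 => g (u : ℝ)) γ.1)

/-- Two boundary points are antipodal if they are joined by a complete geodesic. -/
def Antipodal {X : Type*} [MetricSpace X] (ξ ζ : Boundary X) : Prop :=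
  ∃ g : ℝ → X, LineConnects g ξ ζ

/-- Two measures on the boundary are antipodal if they are concentrated on antipodal sets. -/
def AntipodalMeasures {X : Type*} [MetricSpace X] (νm νp : Measure (Boundary X)) : Prop :=
  ∃ A B : Set (Boundary X), MeasurableSet A ∧ MeasurableSet B ∧ νm A = 1 ∧ νp B = 1 ∧
    ∀ ξ ∈ A, ∀ ζ ∈ B, Antipodal ξ ζ

/-- Two measures on the boundary are uniformly antipodal if their supports are antipodal. -/
def UniformlyAntipodal {X : Type*} [MetricSpace X] (νm νp : Measure (Boundary X)) : Prop :=
  ∀ ξ ∈ msupport νm, ∀ ζ ∈ msupport νp, Antipodal ξ ζ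

/-- The distance from the base point `x₀` to the geodesic line joining two boundary points
(for trees, the Gromov product). -/
def D0 {X : Type*} [MetricSpace X] (x₀ : X) (ξ ζ : Boundary X) : ℝ :=
  sInf {r : ℝ | ∃ g : ℝ → X, LineConnects g ξ ζ ∧ ∃ t : ℝ, r = dist x₀ (g t)}

/-- The unit geodesic from `ξ` to `ζ`, parametrized so that its time-`0` point is closest to
the base point `x₀`. -/
def lineFrom {X : Type*} [MetricSpace X] (x₀ : X) (ξ ζ : Boundary X) : ℝ → X :=
  haveI : Nonempty X := ⟨x₀⟩
  Classical.epsilon fun g : ℝ → X =>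
    LineConnects g ξ ζ ∧ dist x₀ (g 0) = D0 x₀ ξ ζ

/-! ## Flows on trees -/

/-- The set of boundary points whose rays eventually lie in `C`. -/
def compBdry {X : Type*} [MetricSpace X] (C : Set X) : Set (Boundary X) :=
  {ξ | ∀ γ : UnitRay X, Quotient.mk (unitRaySetoid X) γ = ξ →
    ∃ T : ℝ≥0, ∀ t : ℝ≥0, T ≤ t → γ.1 t ∈ C}

/-- The connected components of the complement of a point. -/
def treeComps {X : Type*} [TopologicalSpace X] (x : X) : Set (Set X) :=
  {C | ∃ y : X, y ≠ x ∧ C = connectedComponentIn {x}ᶜ y}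

/-- A vertex (branch point) of a tree: the complement has at least three components. -/
def IsTreeVertex {X : Type*} [TopologicalSpace X] (x : X) : Prop :=
  ∃ C₁ C₂ C₃ : Set X, C₁ ∈ treeComps x ∧ C₂ ∈ treeComps x ∧ C₃ ∈ treeComps x ∧
    C₁ ≠ C₂ ∧ C₂ ≠ C₃ ∧ C₁ ≠ C₃

/-- The value of the signed measure `ν₊ - ν₋` on a set of boundary points. -/
def sflow {X : Type*} [MetricSpace X] (νm νp : Measure (Boundary X))
    (S : Set (Boundary X)) : ℝ :=
  (νp S).toReal - (νm S).toReal

/-- The boundary directions at `x` carrying positive flow. -/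
def posBdrySet {X : Type*} [MetricSpace X] (νm νp : Measure (Boundary X)) (x : X) :
    Set (Boundary X) :=
  ⋃ (C : Set X) (_ : C ∈ treeComps x) (_ : 0 < sflow νm νp (compBdry C)), compBdry C

/-- The boundary directions at `x` carrying negative flow. -/
def negBdrySet {X : Type*} [MetricSpace X] (νm νp : Measure (Boundary X)) (x : X) :
    Set (Boundary X) :=
  ⋃ (C : Set X) (_ : C ∈ treeComps x) (_ : sflow νm νp (compBdry C) < 0), compBdry C

/-- The flow through the point `x`. -/
def flowAt {X : Type*} [MetricSpace X] (νm νp : Measure (Boundary X)) (x : X) : ℝ :=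
  sflow νm νp (posBdrySet νm νp x)

open Classical in
/-- The specific flow through `x`: the flow through `x`, not counting the edge pointing
towards the base point `x₀` when the latter is positive (resp. negative). -/
def specificFlow {X : Type*} [MetricSpace X] (νm νp : Measure (Boundary X))
    (x₀ x : X) : ℝ :=
  if x = x₀ then flowAt νm νp x
  else if 0 < sflow νm νp (compBdry (connectedComponentIn {x}ᶜ x₀)) then
    sflow νm νp (posBdrySet νm νp x \ compBdry (connectedComponentIn {x}ᶜ x₀))
  else if sflow νm νp (compBdry (connectedComponentIn {x}ᶜ x₀)) < 0 then
    - sflow νm νp (negBdrySet νm νp x \ compBdry (connectedComponentIn {x}ᶜ x₀))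
  else flowAt νm νp x

/-- The pair `(ν₋, ν₊)` is realized as the pair of ends of a complete unit-speed geodesic of
the Wasserstein space, through a displacement interpolation `m`. -/
def RealizableEnds {X : Type*} [MetricSpace X] [MeasurableSpace X]
    (νm νp : Measure (Boundary X)) : Prop :=
  ∃ (μt : ℝ → W2Space X) (m : Measure (GeoLine X)), IsProbabilityMeasure m ∧
    (∀ s t : ℝ, Wdist (μt s) (μt t) = |s - t|) ∧
    (∀ t : ℝ, m.map (fun γ : GeoLine X => γ.1 t) = (μt t).1) ∧
    m.map lineEndMinus = νm.map (fun ξ : Boundary X => coneMk ξ 1) ∧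
    m.map lineEndPlus = νp.map (fun ξ : Boundary X => coneMk ξ 1)

/-- The cost `∫ D₀² dπ` of a transport plan (the optimal transport problem for the cost
`-D₀²` is finite iff the supremum of this quantity over all couplings is finite, and its
minimizers are the maximizers of this quantity). -/
def D0cost {X : Type*} [MetricSpace X] (x₀ : X)
    (π : Measure (Boundary X × Boundary X)) : ℝ≥0∞ :=
  ∫⁻ p, ENNReal.ofReal (D0 x₀ p.1 p.2) ^ 2 ∂π

/-- The supremum of `∫ D₀² dπ` over couplings of `(ν₋, ν₊)`. -/
def D0supCost {X : Type*} [MetricSpace X] (x₀ : X) (νm νp : Measure (Boundary X)) : ℝ≥0∞ :=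
  ⨆ (π : Measure (Boundary X × Boundary X)) (_ : IsCoupling π νm νp), D0cost x₀ π

/-! ## The geodesic boundary of the Wasserstein space -/

/-- The metric topology of the Wasserstein distance. -/
instance (Y : Type*) [MetricSpace Y] [MeasurableSpace Y] : TopologicalSpace (W2Space Y) :=
  TopologicalSpace.generateFrom
    {S | ∃ (μ : W2Space Y) (ε : ℝ), S = {ν : W2Space Y | Wdist μ ν < ε}}

/-- Unit-speed geodesic rays of the Wasserstein space. -/
abbrev W2UnitRay (X : Type*) [MetricSpace X] [MeasurableSpace X] : Type _ :=
  {f : ℝ≥0 → W2Space X // ∀ s t : ℝ≥0, Wdist (f s) (f t) = dist s t}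

/-- Probability measures on the cone over the boundary with `∫ v² dν = 1`, with the weak
topology. -/
abbrev P1Cone (X : Type*) [MetricSpace X] : Type _ :=
  {ν : ProbabilityMeasure (Cone (Boundary X)) //
    ∫⁻ c, (coneSpeed c : ℝ≥0∞) ^ 2 ∂(ν : Measure (Cone (Boundary X))) = 1}

/-- Probability measures (as plain measures) on the cone over the boundary with
`∫ v² dν = 1`. -/
abbrev P1ConeM (X : Type*) [MetricSpace X] : Type _ :=
  {ν : Measure (Cone (Boundary X)) // IsProbabilityMeasure ν ∧
    ∫⁻ c, (coneSpeed c : ℝ≥0∞) ^ 2 ∂ν = 1}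


/-! ## Locally Riemannian points -/

/-- The Riemannian length of a path `γ : [0,1] → ℝⁿ` for the metric tensor `g`. -/
def riemannianPathLength {n : ℕ}
    (g : EuclideanSpace ℝ (Fin n) → EuclideanSpace ℝ (Fin n) →L[ℝ] EuclideanSpace ℝ (Fin n))
    (γ : ℝ → EuclideanSpace ℝ (Fin n)) : ℝ :=
  ∫ t in (0:ℝ)..1, Real.sqrt (@inner ℝ _ _ (g (γ t) (deriv γ t)) (deriv γ t))

/-- The Riemannian distance in `U ⊆ ℝⁿ` for the metric tensor `g`: the infimum of
Riemannian lengths of `C¹` paths in `U` joining the two points. -/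
def riemannianDist {n : ℕ} (U : Set (EuclideanSpace ℝ (Fin n)))
    (g : EuclideanSpace ℝ (Fin n) → EuclideanSpace ℝ (Fin n) →L[ℝ] EuclideanSpace ℝ (Fin n))
    (p q : EuclideanSpace ℝ (Fin n)) : ℝ :=
  sInf {L : ℝ | ∃ γ : ℝ → EuclideanSpace ℝ (Fin n), ContDiffOn ℝ 1 γ (Set.Icc (0:ℝ) 1) ∧
    (∀ t ∈ Set.Icc (0:ℝ) 1, γ t ∈ U) ∧ γ 0 = p ∧ γ 1 = q ∧ L = riemannianPathLength g γ}

/-- `x` admits a neighborhood isometric to an open subset of a Riemannian manifold of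
dimension at least 2 (expressed in a chart: an open subset of `ℝⁿ`, `n ≥ 2`, equipped with
the distance induced by a smooth positive-definite symmetric metric tensor). -/
def IsLocallyRiemannian (X : Type*) [MetricSpace X] (x : X) : Prop :=
  ∃ n : ℕ, 2 ≤ n ∧
  ∃ (U : Set (EuclideanSpace ℝ (Fin n)))
    (g : EuclideanSpace ℝ (Fin n) → EuclideanSpace ℝ (Fin n) →L[ℝ] EuclideanSpace ℝ (Fin n))
    (V : Set X) (φ : X → EuclideanSpace ℝ (Fin n)),
    IsOpen U ∧ ContDiffOn ℝ (⊤ : ℕ∞) g U ∧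
    (∀ p ∈ U, ∀ v w : EuclideanSpace ℝ (Fin n),
      @inner ℝ _ _ (g p v) w = @inner ℝ _ _ v (g p w)) ∧
    (∀ p ∈ U, ∀ v : EuclideanSpace ℝ (Fin n), v ≠ 0 → 0 < @inner ℝ _ _ (g p v) v) ∧
    V ∈ nhds x ∧ Set.BijOn φ V U ∧
    ∀ a ∈ V, ∀ b ∈ V, dist a b = riemannianDist U g (φ a) (φ b)

/-! ## The combinatorial perpendicular Radon transform on a tree -/

/-- `y` and `z` lie in the same connected component of the graph `G` minus the vertex `x`. -/
def sameComp {V : Type*} (G : SimpleGraph V) (x y z : V) : Prop :=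
  ∃ (hy : y ≠ x) (hz : z ≠ x), (G.induce {w : V | w ≠ x}).Reachable ⟨y, hy⟩ ⟨z, hz⟩

/-- The perpendicular `⊥ˣ(ef)` of a flag: the union of `{x}` and of the components of
`G - x` containing none of the vertices of `p` (for a flag, `p = {e, f}` is a pair of
neighbors of `x`). -/
def perpSet {V : Type*} (G : SimpleGraph V) (x : V) (p : Finset V) : Set V :=
  {x} ∪ {y | ∀ e ∈ p, ¬ sameComp G x y e}

/-- The combinatorial perpendicular Radon transform of a summable function `h` on the
vertices, evaluated on a flag `(x, p)`. -/
def perpRadon {V : Type*} (G : SimpleGraph V) (h : V → ℝ) (x : V) (p : Finset V) : ℝ :=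
  ∑' y : perpSet G x p, h y


/-! ## Geodesic homotheties in a Hadamard space -/

/-- The point at fraction `t` of a geodesic from `x` to `z`. -/
def homothety {X : Type*} [MetricSpace X] (hX : IsHadamard X) (x : X) (t : ℝ) (z : X) : X :=
  (hX.geodesic x z).choose t

section Homothety

variable {X : Type*} [MetricSpace X] (hX : IsHadamard X)

lemma dist_homothety_homothety (x z : X) {s t : ℝ} (hs : s ∈ Icc (0 : ℝ) 1)
    (ht : t ∈ Icc (0 : ℝ) 1) :
    dist (homothety hX x s z) (homothety hX x t z) = |s - t| * dist x z := by
  rw [mul_comm]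
  exact (hX.geodesic x z).choose_spec.2.2 s hs t ht

lemma homothety_zero (x z : X) : homothety hX x 0 z = x :=
  (hX.geodesic x z).choose_spec.1

lemma homothety_one (x z : X) : homothety hX x 1 z = z :=
  (hX.geodesic x z).choose_spec.2.1

lemma dist_homothety_sq_le (w x z : X) {t : ℝ} (ht : t ∈ Icc (0 : ℝ) 1) :
    dist w (homothety hX x t z) ^ 2 ≤
      (1 - t) * dist w x ^ 2 + t * dist w z ^ 2 - t * (1 - t) * dist x z ^ 2 :=
  hX.cat0 w x z _ (homothety_zero hX x z) (homothety_one hX x z)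
    (hX.geodesic x z).choose_spec.2.2 t ht

lemma dist_left_homothety (x z : X) {t : ℝ} (ht : t ∈ Icc (0 : ℝ) 1) :
    dist x (homothety hX x t z) = t * dist x z := by
  have h := dist_homothety_homothety hX x z (left_mem_Icc.2 zero_le_one) ht
  rwa [homothety_zero, zero_sub, abs_neg, abs_of_nonneg ht.1] at h

lemma dist_homothety_right (x z : X) {t : ℝ} (ht : t ∈ Icc (0 : ℝ) 1) :
    dist (homothety hX x t z) z = (1 - t) * dist x z := by
  have h := dist_homothety_homothety hX x z ht (right_mem_Icc.2 zero_le_one)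
  rwa [homothety_one, abs_sub_comm, abs_of_nonneg (sub_nonneg.2 ht.2)] at h

lemma eq_homothety {x z m : X} {t : ℝ} (ht : t ∈ Icc (0 : ℝ) 1)
    (h1 : dist x m = t * dist x z) (h2 : dist m z = (1 - t) * dist x z) :
    m = homothety hX x t z := by
  have h := dist_homothety_sq_le hX m x z ht
  rw [dist_comm m x, h1, h2] at h
  have h0 : dist m (homothety hX x t z) ^ 2 ≤ 0 := h.trans (le_of_eq (by ring))
  exact dist_eq_zero.1 (pow_eq_zero_iff two_ne_zero |>.1 (le_antisymm h0 (sq_nonneg _)))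

lemma homothety_symm (x z : X) {t : ℝ} (ht : t ∈ Icc (0 : ℝ) 1) :
    homothety hX x t z = homothety hX z (1 - t) x := by
  refine eq_homothety hX ⟨by linarith [ht.2], by linarith [ht.1]⟩ ?_ ?_
  · rw [dist_comm, dist_homothety_right hX x z ht, dist_comm x z]
  · rw [dist_comm, dist_left_homothety hX x z ht, dist_comm x z, sub_sub_cancel]

lemma homothety_comp (x z : X) {s t : ℝ} (hs : s ∈ Icc (0 : ℝ) 1) (ht : t ∈ Icc (0 : ℝ) 1) :
    homothety hX x s (homothety hX x t z) = homothety hX x (s * t) z := by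
  have hst : s * t ∈ Icc (0 : ℝ) 1 :=
    ⟨mul_nonneg hs.1 ht.1, mul_le_one₀ hs.2 ht.1 ht.2⟩
  have hle : s * t ≤ t := mul_le_of_le_one_left ht.1 hs.2
  refine (eq_homothety hX hs ?_ ?_).symm
  · rw [dist_left_homothety hX x z hst, dist_left_homothety hX x z ht]
    ring
  · rw [dist_homothety_homothety hX x z hst ht, dist_left_homothety hX x z ht, abs_sub_comm,
      abs_of_nonneg (sub_nonneg.2 hle)]
    ring

lemma dist_homothety_le (x z z' : X) {t : ℝ} (ht : t ∈ Icc (0 : ℝ) 1) :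
    dist (homothety hX x t z) (homothety hX x t z') ≤ t * dist z z' := by
  have h1 := dist_homothety_sq_le hX (homothety hX x t z) x z' ht
  have h2 := dist_homothety_sq_le hX z' x z ht
  rw [dist_comm _ x, dist_left_homothety hX x z ht, dist_comm _ z'] at h1
  rw [dist_comm z' x, dist_comm z' z] at h2
  refine abs_le_of_sq_le_sq' ?_ (mul_nonneg ht.1 dist_nonneg) |>.2
  nlinarith [mul_le_mul_of_nonneg_left h2 ht.1]

lemma dist_homothety_homothety_le (x y z : X) {t : ℝ} (ht : t ∈ Icc (0 : ℝ) 1) :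
    dist (homothety hX x t z) (homothety hX y t z) ≤ (1 - t) * dist x y := by
  rw [homothety_symm hX x z ht, homothety_symm hX y z ht]
  exact dist_homothety_le hX z x y ⟨by linarith [ht.2], by linarith [ht.1]⟩

lemma continuous_homothety (x : X) {t : ℝ} (ht : t ∈ Icc (0 : ℝ) 1) :
    Continuous (homothety hX x t) :=
  (LipschitzWith.of_dist_le_mul (K := ⟨t, ht.1⟩) fun z z' =>
    dist_homothety_le hX x z z' ht).continuous

end Homothety

/-! ## Transport costs -/

section Cost

lemma lintegral_sq_le_of_le_add {Z : Type*} [MeasurableSpace Z] {m : Measure Z}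
    {F G H : Z → ℝ≥0∞} (hF : AEMeasurable F m) (hG : AEMeasurable G m) {b c : ℝ≥0∞}
    (hH : ∀ z, H z ≤ F z + G z) (hb : ∫⁻ z, F z ^ 2 ∂m ≤ b ^ 2) (hc : ∫⁻ z, G z ^ 2 ∂m ≤ c ^ 2) :
    ∫⁻ z, H z ^ 2 ∂m ≤ (b + c) ^ 2 := by
  have key := ENNReal.lintegral_Lp_add_le hF hG (p := 2) one_le_two
  simp only [Pi.add_apply, ENNReal.rpow_two] at key
  have hroot : ∀ {u v : ℝ≥0∞}, u ≤ v ^ 2 → u ^ (1 / 2 : ℝ) ≤ v := by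
    intro u v huv
    have := ENNReal.rpow_le_rpow huv (z := 1 / 2) (by norm_num)
    rwa [← ENNReal.rpow_two, ← ENNReal.rpow_mul, mul_one_div_cancel two_ne_zero,
      ENNReal.rpow_one] at this
  have h2 := key.trans (add_le_add (hroot hb) (hroot hc))
  have h3 : ∫⁻ z, (F z + G z) ^ 2 ∂m ≤ (b + c) ^ 2 := by
    have := ENNReal.rpow_le_rpow h2 (z := 2) (by norm_num)
    rwa [← ENNReal.rpow_mul, one_div_mul_cancel two_ne_zero, ENNReal.rpow_one,
      ENNReal.rpow_two] at this
  exact (lintegral_mono fun z => pow_le_pow_left' (hH z) 2).trans h3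

variable {X : Type*} [MetricSpace X] [MeasurableSpace X]

lemma Wdist_nonneg (μ ν : W2Space X) : 0 ≤ Wdist μ ν := Real.sqrt_nonneg _

lemma W2cost_eq_edist (μ ν : Measure X) :
    W2cost μ ν = ⨅ (π : Measure (X × X)) (_ : IsCoupling π μ ν), ∫⁻ p, edist p.1 p.2 ^ 2 ∂π := by
  simp only [W2cost, edist_dist]

lemma IsCoupling.W2cost_le {π : Measure (X × X)} {μ ν : Measure X} (hπ : IsCoupling π μ ν) :
    W2cost μ ν ≤ ∫⁻ p, edist p.1 p.2 ^ 2 ∂π := by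
  rw [W2cost_eq_edist]
  exact iInf₂_le π hπ

variable [BorelSpace X]

lemma W2cost_dirac (x : X) (μ : Measure X) [IsProbabilityMeasure μ] :
    W2cost (Measure.dirac x) μ = ∫⁻ z, edist x z ^ 2 ∂μ := by
  have hmeas : Measurable fun z : X => edist x z ^ 2 := by fun_prop
  have hcost : ∀ π : Measure (X × X), IsCoupling π (Measure.dirac x) μ →
      ∫⁻ p, edist p.1 p.2 ^ 2 ∂π = ∫⁻ z, edist x z ^ 2 ∂μ := by
    rintro π ⟨h1, h2⟩
    have hae : ∀ᵐ p ∂π, p.1 = x := by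
      refine ae_of_ae_map (p := fun z => z = x) measurable_fst.aemeasurable ?_
      rw [h1]
      exact (ae_dirac_iff (measurableSet_singleton x)).2 rfl
    rw [← h2, lintegral_map hmeas measurable_snd]
    exact lintegral_congr_ae (hae.mono fun p hp => by simp only [hp])
  have hmk : Measurable (Prod.mk x : X → X × X) := measurable_prodMk_left
  have hcoup : IsCoupling (μ.map (Prod.mk x)) (Measure.dirac x) μ := by
    constructor
    · rw [Measure.map_map measurable_fst hmk]
      change μ.map (fun _ => x) = _
      rw [Measure.map_const, measure_univ, one_smul]
    · rw [Measure.map_map measurable_snd hmk]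
      exact Measure.map_id
  refine le_antisymm (hcoup.W2cost_le.trans_eq (hcost _ hcoup)) ?_
  rw [W2cost_eq_edist]
  exact le_iInf₂ fun π hπ => (hcost π hπ).ge

lemma lintegral_edist_sq_lt_top (x : X) (μ : W2Space X) : ∫⁻ z, edist x z ^ 2 ∂μ.1 < ⊤ := by
  obtain ⟨μ, hμ, y, hy⟩ := μ
  simp only [← edist_dist] at hy
  have h := lintegral_sq_le_of_le_add (m := μ) (F := fun _ => edist x y) (G := fun z => edist y z)
    (H := fun z => edist x z) (b := edist x y) (c := (∫⁻ z, edist y z ^ 2 ∂μ) ^ (1 / 2 : ℝ))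
    (by fun_prop) (by fun_prop) (fun z => edist_triangle x y z) (by simp) (by
      rw [← ENNReal.rpow_two, ← ENNReal.rpow_mul, one_div_mul_cancel two_ne_zero,
        ENNReal.rpow_one])
  exact h.trans_lt (ENNReal.pow_lt_top (ENNReal.add_lt_top.2
    ⟨edist_lt_top x y, ENNReal.rpow_lt_top_of_nonneg (by norm_num) hy.ne⟩))

variable [SecondCountableTopology X]

lemma W2cost_lt_top (μ ν : W2Space X) : W2cost μ.1 ν.1 < ⊤ := by
  have := μ.2.1
  have := ν.2.1
  obtain ⟨x, -⟩ := μ.2.2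
  have hcoup : IsCoupling (μ.1.prod ν.1) μ.1 ν.1 := by
    constructor
    · simp
    · simp
  have hroot : ∀ u : ℝ≥0∞, u ≤ (u ^ (1 / 2 : ℝ)) ^ 2 := fun u => by
    rw [← ENNReal.rpow_two, ← ENNReal.rpow_mul, one_div_mul_cancel two_ne_zero, ENNReal.rpow_one]
  refine hcoup.W2cost_le.trans_lt ?_
  have h := lintegral_sq_le_of_le_add (m := μ.1.prod ν.1) (F := fun p => edist x p.1)
    (G := fun p => edist x p.2) (H := fun p => edist p.1 p.2) (by fun_prop) (by fun_prop)
    (fun p => edist_triangle_left p.1 p.2 x) (hroot _) (hroot _)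
  refine h.trans_lt (ENNReal.pow_lt_top (ENNReal.add_lt_top.2 ⟨?_, ?_⟩))
  · refine ENNReal.rpow_lt_top_of_nonneg (by norm_num) (ne_of_lt ?_)
    rw [← lintegral_map (f := fun z : X => edist x z ^ 2) (by fun_prop) measurable_fst, hcoup.1]
    exact lintegral_edist_sq_lt_top x μ
  · refine ENNReal.rpow_lt_top_of_nonneg (by norm_num) (ne_of_lt ?_)
    rw [← lintegral_map (f := fun z : X => edist x z ^ 2) (by fun_prop) measurable_snd, hcoup.2]
    exact lintegral_edist_sq_lt_top x ν

lemma W2cost_eq_Wdist_sq (μ ν : W2Space X) :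
    W2cost μ.1 ν.1 = ENNReal.ofReal (Wdist μ ν) ^ 2 := by
  rw [← ENNReal.ofReal_pow (Wdist_nonneg μ ν), Wdist, Real.sq_sqrt ENNReal.toReal_nonneg,
    ENNReal.ofReal_toReal (W2cost_lt_top μ ν).ne]

lemma Wdist_le_of_W2cost_le {μ ν : W2Space X} {c : ℝ} (hc : 0 ≤ c)
    (h : W2cost μ.1 ν.1 ≤ ENNReal.ofReal c ^ 2) : Wdist μ ν ≤ c := by
  rw [W2cost_eq_Wdist_sq] at h
  exact (ENNReal.ofReal_le_ofReal_iff hc).1 ((ENNReal.pow_le_pow_left_iff two_ne_zero).1 h)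

lemma exists_coupling_lt {μ ν : W2Space X} {c : ℝ} (h : Wdist μ ν < c) :
    ∃ π : Measure (X × X), IsCoupling π μ.1 ν.1 ∧
      ∫⁻ p, edist p.1 p.2 ^ 2 ∂π < ENNReal.ofReal c ^ 2 := by
  have h' : W2cost μ.1 ν.1 < ENNReal.ofReal c ^ 2 := by
    rw [W2cost_eq_Wdist_sq]
    have hc : 0 < c := (Wdist_nonneg μ ν).trans_lt h
    exact ENNReal.pow_lt_pow_left two_ne_zero ((ENNReal.ofReal_lt_ofReal_iff hc).2 h)
  rw [W2cost_eq_edist] at h'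
  simpa only [iInf_lt_iff, exists_prop] using h'

lemma W2cost_map_map_le {Z : Type*} [MeasurableSpace Z] (m : Measure Z) {f g : Z → X}
    (hf : Measurable f) (hg : Measurable g) :
    W2cost (m.map f) (m.map g) ≤ ∫⁻ z, edist (f z) (g z) ^ 2 ∂m := by
  have hfg := hf.prodMk hg
  have hcoup : IsCoupling (m.map fun z => (f z, g z)) (m.map f) (m.map g) := by
    constructor
    · rw [Measure.map_map measurable_fst hfg]; rfl
    · rw [Measure.map_map measurable_snd hfg]; rfl
  refine hcoup.W2cost_le.trans_eq ?_
  rw [lintegral_map (by fun_prop) hfg]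

lemma measure_le_thickening_add {π : Measure (X × X)} {μ ν : Measure X} (hπ : IsCoupling π μ ν)
    {F : Set X} (hF : IsClosed F) {δ : ℝ} (hδ : 0 < δ) :
    μ F ≤ ν (Metric.thickening δ F) +
      (∫⁻ p, edist p.1 p.2 ^ 2 ∂π) / ENNReal.ofReal δ ^ 2 := by
  have hsub : Prod.fst ⁻¹' F ⊆ Prod.snd ⁻¹' Metric.thickening δ F ∪
      {p : X × X | ENNReal.ofReal δ ^ 2 ≤ edist p.1 p.2 ^ 2} := by
    intro p hp
    rcases lt_or_ge (edist p.1 p.2) (ENNReal.ofReal δ) with h | h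
    · refine Or.inl (Metric.mem_thickening_iff.2 ⟨p.1, hp, ?_⟩)
      rwa [dist_comm, ← edist_lt_ofReal]
    · exact Or.inr (pow_le_pow_left' h 2)
  calc μ F = π (Prod.fst ⁻¹' F) := by
        rw [← hπ.1, Measure.map_apply measurable_fst hF.measurableSet]
    _ ≤ π (Prod.snd ⁻¹' Metric.thickening δ F) +
        π {p : X × X | ENNReal.ofReal δ ^ 2 ≤ edist p.1 p.2 ^ 2} :=
      (measure_mono hsub).trans (measure_union_le _ _)
    _ ≤ _ := by
      gcongr
      · rw [← hπ.2, Measure.map_apply measurable_snd Metric.isOpen_thickening.measurableSet]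
      · refine meas_ge_le_lintegral_div (by fun_prop) ?_ (by simp)
        simpa using hδ

lemma measure_closed_le_of_W2cost_eq_zero {μ ν : Measure X} [IsFiniteMeasure ν]
    (h : W2cost μ ν = 0) {F : Set X} (hF : IsClosed F) : μ F ≤ ν F := by
  have hthick : ∀ δ : ℝ, 0 < δ → μ F ≤ ν (Metric.thickening δ F) := by
    intro δ hδ
    refine ENNReal.le_of_forall_pos_le_add fun η hη _ => ?_
    have hpos : 0 < (η : ℝ≥0∞) * ENNReal.ofReal δ ^ 2 := by
      have := ENNReal.ofReal_pos.2 hδ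
      exact ENNReal.mul_pos (by simpa using hη.ne') (pow_ne_zero 2 this.ne')
    rw [← h, W2cost_eq_edist] at hpos
    simp only [iInf_lt_iff] at hpos
    obtain ⟨π, hπ, hlt⟩ := hpos
    refine (measure_le_thickening_add hπ hF hδ).trans ?_
    gcongr
    exact ENNReal.div_le_of_le_mul hlt.le
  have hlim := tendsto_measure_thickening_of_isClosed (μ := ν) (s := F)
    ⟨1, one_pos, measure_ne_top _ _⟩ hF
  exact ge_of_tendsto hlim (eventually_mem_nhdsWithin.mono fun δ hδ => hthick δ hδ)

lemma W2cost_comm (μ ν : Measure X) : W2cost μ ν = W2cost ν μ := by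
  have key : ∀ μ ν : Measure X, W2cost μ ν ≤ W2cost ν μ := by
    intro μ ν
    rw [W2cost_eq_edist ν μ]
    refine le_iInf₂ fun π hπ => ?_
    have h := W2cost_map_map_le π (measurable_snd (α := X) (β := X)) measurable_fst
    rw [hπ.1, hπ.2] at h
    simpa only [edist_comm] using h
  exact le_antisymm (key μ ν) (key ν μ)

lemma eq_of_W2cost_eq_zero {μ ν : Measure X} [IsProbabilityMeasure μ] [IsProbabilityMeasure ν]
    (h : W2cost μ ν = 0) : μ = ν := by
  refine ext_of_generate_finite {F : Set X | IsClosed F} ?_ isPiSystem_isClosed (fun F hF => ?_)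
    (by simp)
  · rw [BorelSpace.measurable_eq (α := X), borel_eq_generateFrom_isClosed]
  · exact le_antisymm (measure_closed_le_of_W2cost_eq_zero h hF)
      (measure_closed_le_of_W2cost_eq_zero (W2cost_comm μ ν ▸ h) hF)

end Cost

/-! ## Geodesics of the Wasserstein space issued from a Dirac mass -/

section DiracGeodesic

variable {X : Type*} [MetricSpace X] [MeasurableSpace X] [BorelSpace X]
  [SecondCountableTopology X]

lemma lintegral_edist_sq_eq_Wdist_sq {x : X} {δ : W2Space X} (hδ : δ.1 = Measure.dirac x)
    (μ : W2Space X) : ∫⁻ z, edist x z ^ 2 ∂μ.1 = ENNReal.ofReal (Wdist δ μ) ^ 2 := by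
  have := μ.2.1
  rw [← W2cost_dirac, ← hδ, W2cost_eq_Wdist_sq]

lemma abs_Wdist_dirac_sub_le {x y : X} {δ δ' : W2Space X} (hδ : δ.1 = Measure.dirac x)
    (hδ' : δ'.1 = Measure.dirac y) (μ : W2Space X) :
    |Wdist δ μ - Wdist δ' μ| ≤ dist x y := by
  have key : ∀ {x y : X} {δ δ' : W2Space X}, δ.1 = Measure.dirac x → δ'.1 = Measure.dirac y →
      Wdist δ μ ≤ dist x y + Wdist δ' μ := by
    intro x y δ δ' hδ hδ'
    have := μ.2.1
    refine Wdist_le_of_W2cost_le (add_nonneg dist_nonneg (Wdist_nonneg _ _)) ?_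
    rw [hδ, W2cost_dirac, ENNReal.ofReal_add dist_nonneg (Wdist_nonneg _ _), ← edist_dist]
    exact lintegral_sq_le_of_le_add (F := fun _ => edist x y) (G := fun z => edist y z)
      (by fun_prop) (by fun_prop) (fun z => edist_triangle x y z) (by simp)
      (lintegral_edist_sq_eq_Wdist_sq hδ' μ).le
  rw [abs_sub_le_iff]
  constructor
  · linarith [key hδ hδ']
  · linarith [key hδ' hδ, dist_comm x y]

/-- A measure between a Dirac mass and `μ` is the image of `μ` by a homothety. -/
lemma eq_map_homothety (hX : IsHadamard X) {y : X} {δ ν μ : W2Space X}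
    (hδ : δ.1 = Measure.dirac y) {t : ℝ} (ht : t ∈ Icc (0 : ℝ) 1)
    (h1 : Wdist δ ν = t * Wdist δ μ) (h2 : Wdist ν μ = (1 - t) * Wdist δ μ) :
    ν.1 = μ.1.map (homothety hX y t) := by
  have := μ.2.1
  have := ν.2.1
  have hmeas := (continuous_homothety hX y ht).measurable
  have : IsProbabilityMeasure (μ.1.map (homothety hX y t)) :=
    Measure.isProbabilityMeasure_map hmeas.aemeasurable
  have ht1 : 0 ≤ 1 - t := sub_nonneg.2 ht.2
  set D := Wdist δ μ with hD
  have hD0 : 0 ≤ D := Wdist_nonneg _ _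
  refine eq_of_W2cost_eq_zero (le_antisymm (ENNReal.le_of_forall_pos_le_add ?_) zero_le)
  intro η hη _
  have hη' : (0 : ℝ) < η := hη
  obtain ⟨π, hπ, hlt⟩ := exists_coupling_lt
    (show Wdist ν μ < √(((1 - t) * D) ^ 2 + η) from by
      rw [h2]
      exact Real.lt_sqrt_of_sq_lt (by linarith))
  rw [← ENNReal.ofReal_pow (Real.sqrt_nonneg _), Real.sq_sqrt (by positivity)] at hlt
  have hle : W2cost ν.1 (μ.1.map (homothety hX y t)) ≤
      ∫⁻ p, edist p.1 (homothety hX y t p.2) ^ 2 ∂π := by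
    have h := W2cost_map_map_le π (measurable_fst (α := X) (β := X)) (hmeas.comp measurable_snd)
    rwa [← Measure.map_map hmeas measurable_snd, hπ.1, hπ.2] at h
  have hν : ∫⁻ p, edist y p.1 ^ 2 ∂π = ENNReal.ofReal ((t * D) ^ 2) := by
    rw [← lintegral_map (f := fun z : X => edist y z ^ 2) (by fun_prop) measurable_fst, hπ.1,
      lintegral_edist_sq_eq_Wdist_sq hδ, h1, ENNReal.ofReal_pow (mul_nonneg ht.1 hD0)]
  have hμ : ∫⁻ p, edist y p.2 ^ 2 ∂π = ENNReal.ofReal (D ^ 2) := by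
    rw [← lintegral_map (f := fun z : X => edist y z ^ 2) (by fun_prop) measurable_snd, hπ.2,
      lintegral_edist_sq_eq_Wdist_sq hδ, ENNReal.ofReal_pow hD0]
  have hpt : ∀ p : X × X, edist p.1 (homothety hX y t p.2) ^ 2 +
      ENNReal.ofReal (t * (1 - t)) * edist y p.2 ^ 2 ≤
      ENNReal.ofReal (1 - t) * edist y p.1 ^ 2 + ENNReal.ofReal t * edist p.1 p.2 ^ 2 := by
    intro p
    have h := dist_homothety_sq_le hX p.1 y p.2 ht
    rw [dist_comm p.1 y] at h
    simp only [edist_dist, ← ENNReal.ofReal_pow dist_nonneg]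
    rw [← ENNReal.ofReal_mul (mul_nonneg ht.1 ht1), ← ENNReal.ofReal_mul ht1,
      ← ENNReal.ofReal_mul ht.1, ← ENNReal.ofReal_add (by positivity)
        (mul_nonneg (mul_nonneg ht.1 ht1) (sq_nonneg _)),
      ← ENNReal.ofReal_add (mul_nonneg ht1 (sq_nonneg _)) (mul_nonneg ht.1 (sq_nonneg _))]
    exact ENNReal.ofReal_le_ofReal (by linarith)
  have hint := lintegral_mono (μ := π) hpt
  rw [lintegral_add_right _ (by fun_prop), lintegral_add_right _ (by fun_prop),
    lintegral_const_mul _ (by fun_prop), lintegral_const_mul _ (by fun_prop),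
    lintegral_const_mul _ (by fun_prop), hμ, hν, ← ENNReal.ofReal_mul (mul_nonneg ht.1 ht1),
    ← ENNReal.ofReal_mul ht1] at hint
  have hbound : ENNReal.ofReal ((1 - t) * (t * D) ^ 2) +
      ENNReal.ofReal t * ∫⁻ p, edist p.1 p.2 ^ 2 ∂π ≤
      η + ENNReal.ofReal (t * (1 - t) * D ^ 2) := by
    calc _ ≤ ENNReal.ofReal ((1 - t) * (t * D) ^ 2) +
          ENNReal.ofReal t * ENNReal.ofReal (((1 - t) * D) ^ 2 + η) := by gcongr
      _ = ENNReal.ofReal ((1 - t) * (t * D) ^ 2 + t * (((1 - t) * D) ^ 2 + η)) := by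
          rw [← ENNReal.ofReal_mul ht.1, ← ENNReal.ofReal_add (mul_nonneg ht1 (sq_nonneg _))
            (mul_nonneg ht.1 (by positivity))]
      _ ≤ ENNReal.ofReal (η + t * (1 - t) * D ^ 2) := by
          apply ENNReal.ofReal_le_ofReal
          nlinarith [mul_le_of_le_one_left hη'.le ht.2]
      _ = _ := by
          rw [ENNReal.ofReal_add hη'.le (mul_nonneg (mul_nonneg ht.1 ht1) (sq_nonneg _)),
            ENNReal.ofReal_coe_nnreal]
  have hfin := (ENNReal.add_le_add_iff_right ENNReal.ofReal_ne_top).1 (hint.trans hbound)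
  simpa using hle.trans hfin

lemma geodesic_eq_map_homothety (hX : IsHadamard X) {y : X} {σ : ℝ≥0 → W2Space X} {t ρ : ℝ≥0}
    (h0 : (σ 0).1 = Measure.dirac y)
    (hσ : ∀ u v : ℝ≥0, u ≤ ρ → v ≤ ρ → Wdist (σ u) (σ v) = dist u v) (hρ : 0 < ρ) (ht : t ≤ ρ) :
    (σ t).1 = (σ ρ).1.map (homothety hX y (t / ρ)) := by
  have hρ' : (0 : ℝ) < ρ := hρ
  have ht' : (t : ℝ) ≤ ρ := ht
  have hD : Wdist (σ 0) (σ ρ) = ρ := by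
    rw [hσ 0 ρ zero_le le_rfl, NNReal.dist_eq]
    simp
  refine eq_map_homothety hX h0 ⟨by positivity, div_le_one_of_le₀ ht' hρ'.le⟩ ?_ ?_
  · rw [hD, hσ 0 t zero_le ht, NNReal.dist_eq, div_mul_cancel₀ _ hρ'.ne']
    simp
  · rw [hD, hσ t ρ ht le_rfl, NNReal.dist_eq, abs_sub_comm, abs_of_nonneg (sub_nonneg.2 ht'),
      sub_mul, div_mul_cancel₀ _ hρ'.ne', one_mul]

end DiracGeodesic

section Convergence

variable {X : Type*} [MetricSpace X] [MeasurableSpace X] [BorelSpace X]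
  [SecondCountableTopology X]

/-- Images of two measures by homotheties of the same centre are close when the measures and
the ratios are. -/
lemma Wdist_homothety_homothety_le (hX : IsHadamard X) {x : X} {δ ν ν' κ κ' : W2Space X}
    (hδ : δ.1 = Measure.dirac x) {b b' : ℝ} (hb : b ∈ Icc (0 : ℝ) 1) (hb' : b' ∈ Icc (0 : ℝ) 1)
    (hκ : κ.1 = ν.1.map (homothety hX x b)) (hκ' : κ'.1 = ν'.1.map (homothety hX x b')) :
    Wdist κ κ' ≤ b' * Wdist ν ν' + |b - b'| * Wdist δ ν := by
  have hm := (continuous_homothety hX x hb).measurable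
  have hm' := (continuous_homothety hX x hb').measurable
  have key : ∀ c : ℝ, Wdist ν ν' < c → Wdist κ κ' ≤ b' * c + |b - b'| * Wdist δ ν := by
    intro c hc
    have hc0 : 0 ≤ c := (Wdist_nonneg _ _).trans hc.le
    have hD := Wdist_nonneg δ ν
    obtain ⟨π, hπ, hlt⟩ := exists_coupling_lt hc
    refine Wdist_le_of_W2cost_le (add_nonneg (mul_nonneg hb'.1 hc0) (by positivity)) ?_
    have h := W2cost_map_map_le π (hm.comp measurable_fst) (hm'.comp measurable_snd)
    rw [← Measure.map_map hm measurable_fst, ← Measure.map_map hm' measurable_snd, hπ.1, hπ.2,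
      ← hκ, ← hκ'] at h
    refine h.trans ?_
    rw [ENNReal.ofReal_add (mul_nonneg hb'.1 hc0) (by positivity)]
    refine lintegral_sq_le_of_le_add (F := fun p => ENNReal.ofReal b' * edist p.1 p.2)
      (G := fun p => ENNReal.ofReal |b - b'| * edist x p.1) (by fun_prop) (by fun_prop)
      (fun p => ?_) ?_ ?_
    · simp only [edist_dist, Function.comp]
      rw [← ENNReal.ofReal_mul hb'.1, ← ENNReal.ofReal_mul (abs_nonneg _),
        ← ENNReal.ofReal_add (mul_nonneg hb'.1 dist_nonneg) (by positivity)]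
      refine ENNReal.ofReal_le_ofReal ((dist_triangle _ (homothety hX x b' p.1) _).trans ?_)
      rw [dist_homothety_homothety hX x p.1 hb hb', add_comm]
      gcongr
      exact dist_homothety_le hX x p.1 p.2 hb'
    · simp only [mul_pow]
      rw [lintegral_const_mul _ (by fun_prop), ENNReal.ofReal_mul hb'.1, mul_pow]
      gcongr
    · simp only [mul_pow]
      rw [lintegral_const_mul _ (by fun_prop), ENNReal.ofReal_mul (abs_nonneg _), mul_pow,
        ← lintegral_map (f := fun z : X => edist x z ^ 2) (by fun_prop) measurable_fst, hπ.1,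
        lintegral_edist_sq_eq_Wdist_sq hδ]
  refine le_of_forall_pos_le_add fun η hη => ?_
  have h := key (Wdist ν ν' + η) (by linarith)
  nlinarith [mul_le_of_le_one_left hη.le hb'.2]

/-- Comparison of a homothety of centre `x` with the composite of homotheties of centres `y`
and `x`. -/
lemma Wdist_homothety_comp_le (hX : IsHadamard X) {x y : X} {δ ν ν' κ κ' : W2Space X}
    (hδ : δ.1 = Measure.dirac x) {b b' l : ℝ} (hb : b ∈ Icc (0 : ℝ) 1)
    (hb' : b' ∈ Icc (0 : ℝ) 1) (hl : l ∈ Icc (0 : ℝ) 1)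
    (hν : ν.1 = ν'.1.map (homothety hX y l))
    (hκ : κ.1 = ν.1.map (homothety hX x b)) (hκ' : κ'.1 = ν'.1.map (homothety hX x b')) :
    Wdist κ κ' ≤ b * ((1 - l) * dist x y) + |b * l - b'| * Wdist δ ν' := by
  have := ν'.2.1
  have hm := (continuous_homothety hX x hb).measurable
  have hml := (continuous_homothety hX y hl).measurable
  have hm' := (continuous_homothety hX x hb').measurable
  have hD := Wdist_nonneg δ ν'
  have hl1 : 0 ≤ 1 - l := sub_nonneg.2 hl.2
  have hc0 : 0 ≤ b * ((1 - l) * dist x y) := mul_nonneg hb.1 (mul_nonneg hl1 dist_nonneg)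
  refine Wdist_le_of_W2cost_le (add_nonneg hc0 (by positivity)) ?_
  rw [hκ, hκ', hν, Measure.map_map hm hml]
  refine (W2cost_map_map_le ν'.1 (hm.comp hml) hm').trans ?_
  rw [ENNReal.ofReal_add hc0 (by positivity)]
  refine lintegral_sq_le_of_le_add (F := fun _ => ENNReal.ofReal (b * ((1 - l) * dist x y)))
    (G := fun z => ENNReal.ofReal |b * l - b'| * edist x z) (by fun_prop) (by fun_prop)
    (fun z => ?_) (by simp) ?_
  · simp only [edist_dist, Function.comp]
    rw [← ENNReal.ofReal_mul (abs_nonneg _), ← ENNReal.ofReal_add hc0 (by positivity)]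
    refine ENNReal.ofReal_le_ofReal
      ((dist_triangle _ (homothety hX x b (homothety hX x l z)) _).trans (add_le_add ?_ ?_))
    · refine (dist_homothety_le hX x _ _ hb).trans (mul_le_mul_of_nonneg_left ?_ hb.1)
      rw [dist_comm]
      exact dist_homothety_homothety_le hX x y z hl
    · rw [homothety_comp hX x z hb hl, dist_homothety_homothety hX x z
        ⟨mul_nonneg hb.1 hl.1, mul_le_one₀ hb.2 hl.1 hl.2⟩ hb']
  · simp only [mul_pow]
    rw [lintegral_const_mul _ (by fun_prop), ENNReal.ofReal_mul (abs_nonneg _), mul_pow,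
      lintegral_edist_sq_eq_Wdist_sq hδ]

end Convergence

/-- **Statement 15.** Given `ε, a, R > 0` there is `T > 0` such that for all `x, y` with
`d(x,y) = a` and every unit-speed geodesic `(μ_t)` of `W₂(X)` of length `> T` starting at
`δ_y`, the unit-speed geodesics `σ^s` from `δ_x` to `μ_s` satisfy
`W(σ^s_R, σ^{s'}_R) < ε` for all `s' > s > T`. In particular, when `(μ_t)` is a ray, the
geodesics `σ^s` converge uniformly on compact subsets, as `s → ∞`, to the unit ray from
`δ_x` asymptotic to `(μ_t)`. -/
theorem convergence_of_geodesics_from_dirac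
    (X : Type*) [MetricSpace X] [MeasurableSpace X] [BorelSpace X]
    (hX : IsHadamard X) (ε a R : ℝ) (hε : 0 < ε) (ha : 0 < a) (hR : 0 < R) :
    ∃ T : ℝ, 0 < T ∧
      ((∀ (x y : X), dist x y = a →
        ∀ (L : ℝ≥0∞) (μ : ℝ≥0 → W2Space X),
          (μ 0).1 = Measure.dirac y →
          (∀ u v : ℝ≥0, (u : ℝ≥0∞) ≤ L → (v : ℝ≥0∞) ≤ L → Wdist (μ u) (μ v) = dist u v) →
          ENNReal.ofReal T < L →
          ∀ s s' : ℝ≥0, T < (s : ℝ) → s < s' → (s' : ℝ≥0∞) ≤ L →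
          ∀ σs σs' : ℝ≥0 → W2Space X,
            ((σs 0).1 = Measure.dirac x ∧
              (∀ u v : ℝ≥0, u ≤ (Wdist (σs 0) (μ s)).toNNReal →
                v ≤ (Wdist (σs 0) (μ s)).toNNReal → Wdist (σs u) (σs v) = dist u v) ∧
              σs ((Wdist (σs 0) (μ s)).toNNReal) = μ s) →
            ((σs' 0).1 = Measure.dirac x ∧
              (∀ u v : ℝ≥0, u ≤ (Wdist (σs' 0) (μ s')).toNNReal →
                v ≤ (Wdist (σs' 0) (μ s')).toNNReal → Wdist (σs' u) (σs' v) = dist u v) ∧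
              σs' ((Wdist (σs' 0) (μ s')).toNNReal) = μ s') →
            Wdist (σs R.toNNReal) (σs' R.toNNReal) < ε) ∧
      (∀ (x y : X), dist x y = a →
        ∀ μ : ℝ≥0 → W2Space X,
          (μ 0).1 = Measure.dirac y →
          (∀ u v : ℝ≥0, Wdist (μ u) (μ v) = dist u v) →
          ∀ f : ℝ≥0 → W2Space X,
            (f 0).1 = Measure.dirac x →
            (∀ u v : ℝ≥0, Wdist (f u) (f v) = dist u v) →
            AsymptoticMaps Wdist f μ →
          ∀ σ : ℝ≥0 → ℝ≥0 → W2Space X,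
            (∀ s : ℝ≥0, (σ s 0).1 = Measure.dirac x ∧
              (∀ u v : ℝ≥0, u ≤ (Wdist (σ s 0) (μ s)).toNNReal →
                v ≤ (Wdist (σ s 0) (μ s)).toNNReal → Wdist (σ s u) (σ s v) = dist u v) ∧
              σ s ((Wdist (σ s 0) (μ s)).toNNReal) = μ s) →
          ∀ ε' : ℝ, 0 < ε' → ∀ R' : ℝ≥0, ∃ S : ℝ≥0, ∀ s : ℝ≥0, S ≤ s →
            ∀ t : ℝ≥0, t ≤ R' → t ≤ (Wdist (σ s 0) (μ s)).toNNReal →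
              Wdist (σ s t) (f t) < ε')) := by
  have := hX.separable
  have : SecondCountableTopology X := UniformSpace.secondCountable_of_separable X
  refine ⟨a + R + 2 * a * R / ε, by positivity, ?_, ?_⟩
  · rintro x y hxy L μ hμ0 hμ - s s' hTs hss' hs'L σ σ' ⟨hσ0, hσ, hσs⟩ ⟨hσ'0, hσ', hσ's⟩
    have hss : (s : ℝ) < s' := hss'
    have hq : 0 < 2 * a * R / ε := by positivity
    have hs : (0 : ℝ) < s := by linarith
    have hs'0 : (0 : ℝ) < s' := hs.trans hss
    have hs'' : 0 < s' := hs'0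
    have hle : ∀ u : ℝ≥0, u ≤ s' → (u : ℝ≥0∞) ≤ L := fun u hu =>
      (ENNReal.coe_le_coe.2 hu).trans hs'L
    have hd : ∀ u : ℝ≥0, u ≤ s' → Wdist (μ 0) (μ u) = u := fun u hu => by
      rw [hμ 0 u (hle 0 zero_le) (hle u hu), NNReal.dist_eq]
      simp
    have h1 := abs_Wdist_dirac_sub_le hσ0 hμ0 (μ s)
    have h2 := abs_Wdist_dirac_sub_le hσ'0 hμ0 (μ s')
    rw [hd s hss'.le, hxy, abs_le] at h1
    rw [hd s' le_rfl, hxy, abs_le] at h2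
    set ρ := Wdist (σ 0) (μ s) with hρ
    set ρ' := Wdist (σ' 0) (μ s') with hρ'
    have hRρ : R ≤ ρ := by linarith
    have hRρ' : R ≤ ρ' := by linarith
    have hρ0 : 0 < ρ := hR.trans_le hRρ
    have hρ'0 : 0 < ρ' := hR.trans_le hRρ'
    have e1 := geodesic_eq_map_homothety hX hσ0 hσ (Real.toNNReal_pos.2 hρ0)
      (Real.toNNReal_le_toNNReal hRρ)
    have e2 := geodesic_eq_map_homothety hX hσ'0 hσ' (Real.toNNReal_pos.2 hρ'0)
      (Real.toNNReal_le_toNNReal hRρ')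
    have e3 := geodesic_eq_map_homothety hX hμ0
      (fun u v hu hv => hμ u v (hle u hu) (hle v hv)) hs'' hss'.le
    rw [hσs, Real.coe_toNNReal _ hR.le, Real.coe_toNNReal _ hρ0.le] at e1
    rw [hσ's, Real.coe_toNNReal _ hR.le, Real.coe_toNNReal _ hρ'0.le] at e2
    have hl : (s / s' : ℝ) ≤ 1 := div_le_one_of_le₀ hss.le hs'0.le
    have hl0 : (0 : ℝ) ≤ s / s' := by positivity
    refine (Wdist_homothety_comp_le hX hσ'0 ⟨by positivity, div_le_one_of_le₀ hRρ hρ0.le⟩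
      ⟨by positivity, div_le_one_of_le₀ hRρ' hρ'0.le⟩ ⟨hl0, hl⟩ e3 e1 e2).trans_lt ?_
    rw [← hρ', hxy]
    set l : ℝ := s / s' with hl_def
    have hls : l * s' = s := div_mul_cancel₀ _ hs'0.ne'
    have hterm : |R / ρ * l - R / ρ'| * ρ' = R / ρ * |l * ρ' - ρ| := by
      rw [← abs_of_pos (show 0 < R / ρ by positivity), ← abs_mul]
      nth_rewrite 2 [← abs_of_pos hρ'0]
      rw [← abs_mul, abs_of_pos (show 0 < R / ρ by positivity)]
      congr 1
      field_simp
    have habs : |l * ρ' - ρ| ≤ l * a + a := by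
      rw [abs_le]
      constructor <;> nlinarith [mul_le_mul_of_nonneg_left h2.1 hl0,
        mul_le_mul_of_nonneg_left h2.2 hl0]
    rw [hterm]
    calc R / ρ * ((1 - l) * a) + R / ρ * |l * ρ' - ρ|
        ≤ R / ρ * ((1 - l) * a) + R / ρ * (l * a + a) := by gcongr
      _ = 2 * a * R / ρ := by ring
      _ < ε := by
        rw [div_lt_iff₀ hρ0, mul_comm ε, ← div_lt_iff₀ hε]
        linarith
  · rintro x y hxy μ hμ0 hμ f hf0 hf ⟨C, hC⟩ σ hσ ε' hε' R'
    have hC0 : 0 ≤ C := (Wdist_nonneg _ _).trans (hC 0)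
    have hK : 0 ≤ R' * (C + a) / ε' := by positivity
    refine ⟨(a + R' + 1 + R' * (C + a) / ε').toNNReal, fun s hs t htR ht => ?_⟩
    obtain ⟨hσ0, hσs, hσμ⟩ := hσ s
    have hs1 : a + R' + 1 + R' * (C + a) / ε' ≤ s := Real.toNNReal_le_iff_le_coe.1 hs
    have htR1 : (t : ℝ) ≤ R' := htR
    have ht0 : (0 : ℝ) ≤ t := t.2
    have hs0 : (0 : ℝ) < s := by linarith [R'.2]
    have hts : (t : ℝ) ≤ s := by linarith
    have h1 := abs_Wdist_dirac_sub_le hσ0 hμ0 (μ s)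
    rw [hμ 0 s, NNReal.dist_eq, NNReal.coe_zero, zero_sub, abs_neg, abs_of_pos hs0, hxy] at h1
    set ρ := Wdist (σ s 0) (μ s) with hρ
    have hρ0 : 0 < ρ := by linarith [(abs_le.1 h1).1, R'.2]
    have htρ : (t : ℝ) ≤ ρ := by linarith [(abs_le.1 h1).1]
    have e1 := geodesic_eq_map_homothety hX hσ0 hσs (Real.toNNReal_pos.2 hρ0) ht
    have e2 := geodesic_eq_map_homothety hX hf0 (fun u v _ _ => hf u v) (ρ := s) hs0 hts
    rw [hσμ, Real.coe_toNNReal _ hρ0.le] at e1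
    refine (Wdist_homothety_homothety_le hX hσ0 ⟨by positivity, div_le_one_of_le₀ htρ hρ0.le⟩
      ⟨by positivity, div_le_one_of_le₀ hts hs0.le⟩ e1 e2).trans_lt ?_
    have hterm : |(t : ℝ) / ρ - t / s| * ρ = t / s * |ρ - s| := by
      have h : (t : ℝ) / ρ - t / s = t / s * (s - ρ) / ρ := by field_simp
      rw [h, abs_div, abs_mul, abs_of_nonneg (show (0 : ℝ) ≤ t / s by positivity),
        abs_of_pos hρ0, div_mul_cancel₀ _ hρ0.ne', abs_sub_comm]
    have hWC : Wdist (μ s) (f s) ≤ C := by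
      rw [show Wdist (μ s) (f s) = Wdist (f s) (μ s) by rw [Wdist, Wdist, W2cost_comm]]
      exact hC s
    rw [← hρ, hterm]
    calc (t : ℝ) / s * Wdist (μ s) (f s) + t / s * |ρ - s| ≤ t / s * C + t / s * a := by gcongr
      _ = t * (C + a) / s := by ring
      _ ≤ R' * (C + a) / s := by gcongr
      _ < ε' := by
        rw [div_lt_iff₀ hs0, mul_comm ε', ← div_lt_iff₀ hε']
        linarith [R'.2]

end
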